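/- Let λ be a real number with λ ≠ 0 and |λ| ≠ 1, and let φ be a C^∞ diffeomorphism from an open neighbourhood U of the origin in ℝⁿ onto an open subset of ℝⁿ with φ(0) = 0 and D₀φ = λ·Id. Then there exist an open neighbourhood V of 0, a C^∞ diffeomorphism ψ from V onto an open neighbourhood of 0 with ψ(0) = 0, and an open neighbourhood W ⊆ U ∩ V of 0 such that ψ(φ(x)) = λ·ψ(x) for all x ∈ W; that is, the germ of φ at 0 is conjugate to the germ of the scalar map x ↦ λx. -/

import Mathlib

open scoped ContDiff

/-- `φ` is a `C^∞` diffeomorphism from the open set `U ⊆ ℝⁿ` onto an open subset of `ℝⁿ`: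
`U` is open, `φ` is `C^∞` on `U`, injective on `U`, the image `φ '' U` is open, and there is a
`C^∞` inverse on the image. -/
def IsSmoothDiffeoOn (n : ℕ) (φ : EuclideanSpace ℝ (Fin n) → EuclideanSpace ℝ (Fin n))
    (U : Set (EuclideanSpace ℝ (Fin n))) : Prop :=
  IsOpen U ∧ ContDiffOn ℝ ∞ φ U ∧ Set.InjOn φ U ∧ IsOpen (φ '' U) ∧
    ∃ χ : EuclideanSpace ℝ (Fin n) → EuclideanSpace ℝ (Fin n),
      ContDiffOn ℝ ∞ χ (φ '' U) ∧ ∀ x ∈ U, χ (φ x) = x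

open scoped Topology

section Contraction

variable {E F G H : Type} [NormedAddCommGroup E] [NormedSpace ℝ E]
  [NormedAddCommGroup F] [NormedSpace ℝ F] [NormedAddCommGroup G] [NormedSpace ℝ G]
  [NormedAddCommGroup H] [NormedSpace ℝ H]

/-- The derivatives of order at most `n` of the functions `e k` are `O(θ ^ k)` uniformly
on `B`. -/
def GeomBound (θ : ℝ) (B : Set E) (n : ℕ) (e : ℕ → E → F) : Prop :=
  ∀ j ≤ n, ∃ C : ℝ, 0 ≤ C ∧ ∀ k, ∀ x ∈ B, ‖iteratedFDeriv ℝ j (e k) x‖ ≤ C * θ ^ k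

theorem GeomBound.mono {θ : ℝ} {B : Set E} {m n : ℕ} {e : ℕ → E → F}
    (he : GeomBound θ B n e) (hmn : m ≤ n) : GeomBound θ B m e :=
  fun j hj => he j (hj.trans hmn)

theorem geomBound_fderiv {θ : ℝ} {B : Set E} {n : ℕ} {e : ℕ → E → F}
    (he : GeomBound θ B (n + 1) e) : GeomBound θ B n (fun k => fderiv ℝ (e k)) := by
  intro j hj
  obtain ⟨C, hC, h⟩ := he (j + 1) (by omega)
  exact ⟨C, hC, fun k x hx => by rw [norm_iteratedFDeriv_fderiv]; exact h k x hx⟩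

theorem GeomBound.add {θ : ℝ} {B : Set E} {n : ℕ} {e f : ℕ → E → F}
    (hes : ∀ k, ContDiff ℝ ∞ (e k)) (hfs : ∀ k, ContDiff ℝ ∞ (f k))
    (he : GeomBound θ B n e) (hf : GeomBound θ B n f) :
    GeomBound θ B n (fun k x => e k x + f k x) := by
  intro j hj
  obtain ⟨C, hC, h⟩ := he j hj
  obtain ⟨C', hC', h'⟩ := hf j hj
  refine ⟨C + C', by positivity, fun k x hx => ?_⟩
  have : iteratedFDeriv ℝ j (fun x => e k x + f k x) x
      = iteratedFDeriv ℝ j (e k) x + iteratedFDeriv ℝ j (f k) x :=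
    iteratedFDeriv_add_apply ((hes k).contDiffAt.of_le (mod_cast le_top))
      ((hfs k).contDiffAt.of_le (mod_cast le_top))
  rw [this]
  calc _ ≤ _ := norm_add_le _ _
    _ ≤ C * θ ^ k + C' * θ ^ k := add_le_add (h k x hx) (h' k x hx)
    _ = _ := by ring

/-- On a compact set, finitely many derivatives of a smooth map have a common bound. -/
theorem IsCompact.exists_bound_iteratedFDeriv {B : Set E} (hB : IsCompact B) {a : E → F}
    (ha : ContDiff ℝ ∞ a) (n : ℕ) :
    ∃ D : ℝ, 1 ≤ D ∧ ∀ j ≤ n, ∀ x ∈ B, ‖iteratedFDeriv ℝ j a x‖ ≤ D := by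
  have h : ∀ j : ℕ, ∃ D : ℝ, ∀ x ∈ B, ‖iteratedFDeriv ℝ j a x‖ ≤ D := fun j =>
    hB.exists_bound_of_continuousOn
      (ha.continuous_iteratedFDeriv (m := j) (mod_cast le_top)).continuousOn
  choose D hD using h
  refine ⟨1 + ∑ j ∈ Finset.range (n + 1), |D j|, ?_, fun j hj x hx => ?_⟩
  · have : 0 ≤ ∑ j ∈ Finset.range (n + 1), |D j| := Finset.sum_nonneg fun _ _ => abs_nonneg _
    linarith
  · have : |D j| ≤ ∑ j ∈ Finset.range (n + 1), |D j| :=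
      Finset.single_le_sum (f := fun j => |D j|) (fun _ _ => abs_nonneg _)
        (Finset.mem_range.2 (by omega))
    linarith [hD j x hx, le_abs_self (D j)]

theorem GeomBound.clm_apply {θ : ℝ} {B : Set E} (hB : IsCompact B) {n : ℕ}
    {e : ℕ → E → F} {a : E → F →L[ℝ] G} (ha : ContDiff ℝ ∞ a)
    (hes : ∀ k, ContDiff ℝ ∞ (e k)) (he : GeomBound θ B n e) :
    GeomBound θ B n (fun k x => a x (e k x)) := by
  intro j hj
  obtain ⟨D, hD1, hD⟩ := hB.exists_bound_iteratedFDeriv ha n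
  choose! C hC0 hC using he
  refine ⟨∑ i ∈ Finset.range (j + 1), (j.choose i : ℝ) * D * C (j - i),
    Finset.sum_nonneg fun i _ => mul_nonneg (by positivity) (hC0 _ (by omega)),
    fun k x hx => ?_⟩
  refine (norm_iteratedFDeriv_clm_apply ha (hes k) x (mod_cast le_top)).trans ?_
  rw [Finset.sum_mul]
  refine Finset.sum_le_sum fun i hi => ?_
  have hi' := Finset.mem_range.1 hi
  have h1 := hD i (by omega) x hx
  have h2 := hC (j - i) (by omega) k x hx
  rw [mul_assoc _ (C _)]
  gcongr

theorem GeomBound.comp {θ : ℝ} {B : Set E} (hB : IsCompact B) {n : ℕ}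
    {e : ℕ → E → F} {φ : E → E} (hφ : ContDiff ℝ ∞ φ) (hφB : Set.MapsTo φ B B) (hθ : 0 ≤ θ)
    (hes : ∀ k, ContDiff ℝ ∞ (e k)) (he : GeomBound θ B n e) :
    GeomBound θ B n (fun k x => e k (φ x)) := by
  intro j hj
  obtain ⟨D, hD1, hD⟩ := hB.exists_bound_iteratedFDeriv hφ n
  choose! C hC0 hC using he
  have hS : 0 ≤ ∑ i ∈ Finset.range (n + 1), C i :=
    Finset.sum_nonneg fun i hi => hC0 i (by have := Finset.mem_range.1 hi; omega)
  refine ⟨j.factorial * (∑ i ∈ Finset.range (n + 1), C i) * D ^ j, by positivity,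
    fun k x hx => ?_⟩
  have key := norm_iteratedFDeriv_comp_le (n := j) (hes k) hφ (mod_cast le_top) x
    (C := (∑ i ∈ Finset.range (n + 1), C i) * θ ^ k) (D := D) ?_ ?_
  · exact key.trans_eq (by ring)
  · intro i hi
    refine (hC i (by omega) k _ (hφB hx)).trans ?_
    gcongr
    exact Finset.single_le_sum (f := C)
      (fun i hi => hC0 i (by have := Finset.mem_range.1 hi; omega))
      (Finset.mem_range.2 (by omega))
  · intro i hi1 hi
    exact (hD i (by omega) x hx).trans (le_self_pow₀ hD1 (by omega))

/-- The map `X ↦ A ∘ X ∘ B` on continuous linear maps. -/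
noncomputable def sandwich (A : F →L[ℝ] G) (B : H →L[ℝ] E) : (E →L[ℝ] F) →L[ℝ] (H →L[ℝ] G) :=
  (ContinuousLinearMap.compL ℝ H F G A).comp ((ContinuousLinearMap.compL ℝ H E F).flip B)

theorem sandwich_apply (A : F →L[ℝ] G) (B : H →L[ℝ] E) (X : E →L[ℝ] F) :
    sandwich A B X = A.comp (X.comp B) := rfl

theorem norm_sandwich_le (A : F →L[ℝ] G) (B : H →L[ℝ] E) : ‖sandwich A B‖ ≤ ‖A‖ * ‖B‖ := by
  refine ContinuousLinearMap.opNorm_le_bound _ (by positivity) fun X => ?_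
  rw [sandwich_apply]
  calc _ ≤ ‖A‖ * ‖X.comp B‖ := ContinuousLinearMap.opNorm_comp_le _ _
    _ ≤ ‖A‖ * (‖X‖ * ‖B‖) := by gcongr; exact ContinuousLinearMap.opNorm_comp_le _ _
    _ = _ := by ring

theorem ContDiff.sandwich {n : ℕ∞} {A : E → F →L[ℝ] G} {B : E → H →L[ℝ] E} (hA : ContDiff ℝ n A)
    (hB : ContDiff ℝ n B) : ContDiff ℝ n (fun x => sandwich (A x) (B x)) :=
  ((ContinuousLinearMap.contDiff _).comp hA).clm_comp ((ContinuousLinearMap.contDiff _).comp hB)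

theorem ContDiff.clm_flip {n : ℕ∞} {A : E → F →L[ℝ] G →L[ℝ] H} (hA : ContDiff ℝ n A) :
    ContDiff ℝ n (fun x => (A x).flip) := by
  have h : ContDiff ℝ n (ContinuousLinearMap.flipₗᵢ ℝ F G H) := LinearIsometryEquiv.contDiff _
  exact h.comp hA

/-- Solutions of a linear recursion over a contraction have geometrically decaying
derivatives of all orders if the inhomogeneity does. -/
theorem geomBound_of_recursion {B : Set E} (hB : IsCompact B) {φ : E → E}
    (hφ : ContDiff ℝ ∞ φ) (hφB : Set.MapsTo φ B B) (hφ1 : ∀ x ∈ B, ‖fderiv ℝ φ x‖ ≤ 1)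
    {q θ : ℝ} (hq : 0 ≤ q) (hqθ : q < θ) (n : ℕ) :
    ∀ {F : Type} [NormedAddCommGroup F] [NormedSpace ℝ F] {L : E → F →L[ℝ] F}
      {e h : ℕ → E → F}, ContDiff ℝ ∞ L → (∀ x ∈ B, ‖L x‖ ≤ q) →
      (∀ k, ContDiff ℝ ∞ (e k)) → (∀ k, ContDiff ℝ ∞ (h k)) →
      (∀ k x, e (k + 1) x = L x (e k (φ x)) + h k x) → GeomBound θ B n h →
      GeomBound θ B n e := by
  have hθ : 0 ≤ θ := hq.trans hqθ.le
  induction n with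
  | zero =>
    intro F _ _ L e h hL hLq hes hhs hrec hh j hj
    obtain rfl : j = 0 := by omega
    obtain ⟨C, hC, hCh⟩ := hh 0 le_rfl
    obtain ⟨D, hD⟩ := hB.exists_bound_of_continuousOn (hes 0).continuous.continuousOn
    have hθq : 0 < θ - q := by linarith
    refine ⟨|D| + C / (θ - q), by positivity, fun k => ?_⟩
    induction k with
    | zero =>
      intro x hx
      have h0 : 0 ≤ C / (θ - q) := by positivity
      simp only [norm_iteratedFDeriv_zero, pow_zero, mul_one]
      linarith [hD x hx, le_abs_self D]
    | succ k ih =>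
      intro x hx
      have h1 := ih _ (hφB hx)
      have h2 := hCh k x hx
      simp only [norm_iteratedFDeriv_zero] at h1 h2 ⊢
      rw [hrec]
      have hC' : C = C / (θ - q) * (θ - q) := by field_simp
      calc _ ≤ ‖L x (e k (φ x))‖ + ‖h k x‖ := norm_add_le _ _
        _ ≤ q * ((|D| + C / (θ - q)) * θ ^ k) + C * θ ^ k := by
            gcongr
            exact ((L x).le_opNorm _).trans (by gcongr; exact hLq x hx)
        _ = (q * |D| + C / (θ - q) * θ) * θ ^ k := by linear_combination θ ^ k * hC'
        _ ≤ (θ * |D| + C / (θ - q) * θ) * θ ^ k := by gcongr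
        _ = _ := by ring
  | succ n ih =>
    intro F _ _ L e h hL hLq hes hhs hrec hh
    have he := ih hL hLq hes hhs hrec (hh.mono n.le_succ)
    have hdφ : ContDiff ℝ ∞ (fderiv ℝ φ) := hφ.fderiv_right le_rfl
    have hdL : ContDiff ℝ ∞ (fun x => (fderiv ℝ L x).flip) :=
      ContDiff.clm_flip (n := ⊤) (hL.fderiv_right le_rfl)
    have hde : ∀ k, ContDiff ℝ ∞ (fderiv ℝ (e k)) := fun k => (hes k).fderiv_right le_rfl
    have hdh : ∀ k, ContDiff ℝ ∞ (fderiv ℝ (h k)) := fun k => (hhs k).fderiv_right le_rfl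
    have hcomp : ∀ k, ContDiff ℝ ∞ (fun x => e k (φ x)) := fun k => (hes k).comp hφ
    have hderiv : GeomBound θ B n (fun k => fderiv ℝ (e k)) := by
      refine ih (L := fun x => sandwich (L x) (fderiv ℝ φ x))
        (h := fun k x => (fderiv ℝ L x).flip (e k (φ x)) + fderiv ℝ (h k) x)
        (hL.sandwich (n := ⊤) hdφ) (fun x hx => ?_) hde
        (fun k => (hdL.clm_apply (hcomp k)).add (hdh k)) (fun k x => ?_) ?_
      · refine (norm_sandwich_le _ _).trans ?_
        calc _ ≤ q * 1 := by gcongr; exacts [hLq x hx, hφ1 x hx]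
          _ = q := mul_one q
      · have hfun : e (k + 1) = fun x => L x (e k (φ x)) + h k x := funext (hrec k)
        have d1 : DifferentiableAt ℝ L x := (hL.differentiable (by simp)).differentiableAt
        have d2 : DifferentiableAt ℝ (h k) x :=
          ((hhs k).differentiable (by simp)).differentiableAt
        have d3 : HasFDerivAt (fun x => e k (φ x)) ((fderiv ℝ (e k) (φ x)).comp (fderiv ℝ φ x)) x :=
          ((hes k).differentiable (by simp)).differentiableAt.hasFDerivAt.comp x
            (hφ.differentiable (by simp)).differentiableAt.hasFDerivAt
        rw [hfun, ((d1.hasFDerivAt.clm_apply d3).fun_add d2.hasFDerivAt).fderiv, sandwich_apply,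
          add_assoc]
      · exact GeomBound.add (fun k => hdL.clm_apply (hcomp k)) hdh
          ((he.comp hB hφ hφB hθ hes).clm_apply hB hdL hcomp) (geomBound_fderiv hh)
    intro j hj
    rcases j with _ | j
    · exact he 0 (by omega)
    · obtain ⟨C, hC, h⟩ := hderiv j (by omega)
      exact ⟨C, hC, fun k x hx => by rw [← norm_iteratedFDeriv_fderiv]; exact h k x hx⟩

/-- A linear functional equation `u = L · (u ∘ φ) + g` over a local contraction `φ` has a
smooth solution near the fixed point if `L` is contracting there. -/
theorem exists_contDiff_solution [FiniteDimensional ℝ E] [CompleteSpace F] {φ : E → E}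
    (hφ : ContDiff ℝ ∞ φ) (hφ0 : φ 0 = 0) (hφ1 : ‖fderiv ℝ φ 0‖ < 1)
    {L : E → F →L[ℝ] F} {g : E → F} (hL : ContDiff ℝ ∞ L) (hg : ContDiff ℝ ∞ g)
    (hL1 : ‖L 0‖ < 1) :
    ∃ u : E → F, ContDiff ℝ ∞ u ∧ ∀ᶠ x in 𝓝 0, u x = L x (u (φ x)) + g x := by
  obtain ⟨q, hq0, hq1⟩ := exists_between hL1
  obtain ⟨θ, hqθ, hθ1⟩ := exists_between hq1
  have hq : 0 ≤ q := (norm_nonneg _).trans hq0.le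
  have hθ : 0 ≤ θ := hq.trans hqθ.le
  have ev : ∀ᶠ x in 𝓝 (0 : E), ‖fderiv ℝ φ x‖ < 1 ∧ ‖L x‖ < q :=
    ((hφ.continuous_fderiv (by simp)).norm.continuousAt.eventually_lt_const hφ1).and
      (hL.continuous.norm.continuousAt.eventually_lt_const hq0)
  obtain ⟨ρ, hρ, hball⟩ := Metric.nhds_basis_closedBall.eventually_iff.1 ev
  have hφle : ∀ x ∈ Metric.closedBall (0 : E) ρ, ‖φ x‖ ≤ ‖x‖ := by
    intro x hx
    have := (convex_closedBall (0 : E) ρ).norm_image_sub_le_of_norm_fderiv_le (𝕜 := ℝ) (f := φ)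
      (C := 1) (fun y _ => (hφ.differentiable (by simp)).differentiableAt)
      (fun y hy => (hball hy).1.le) (Metric.mem_closedBall_self hρ.le) hx
    simpa [hφ0] using this
  have hφB : Set.MapsTo φ (Metric.closedBall 0 ρ) (Metric.closedBall 0 ρ) := by
    intro x hx
    have := hφle x hx
    simp only [mem_closedBall_zero_iff] at hx ⊢
    exact this.trans hx
  have hB := isCompact_closedBall (0 : E) ρ
  let e : ℕ → E → F := fun k => Nat.rec g (fun _ f x => L x (f (φ x))) k
  have he0 : e 0 = g := rfl
  have hes1 : ∀ k, e (k + 1) = fun x => L x (e k (φ x)) := fun k => rfl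
  have hes : ∀ k, ContDiff ℝ ∞ (e k) := by
    intro k
    induction k with
    | zero => exact hg
    | succ k ih => exact hL.clm_apply (ih.comp hφ)
  have hgeom : ∀ n, GeomBound θ (Metric.closedBall 0 ρ) n e := fun n =>
    geomBound_of_recursion hB hφ hφB (fun x hx => (hball hx).1.le) hq hqθ n (h := fun _ _ => 0)
      hL (fun x hx => (hball hx).2.le) hes (fun _ => contDiff_const)
      (fun k x => by simp [hes1]) (fun j _ => ⟨0, le_rfl, fun k x _ => by
        have : iteratedFDeriv ℝ j (fun _ : E => (0 : F)) = 0 := iteratedFDeriv_fun_zero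
        simp [this]⟩)
  have hsum : ∀ x ∈ Metric.closedBall (0 : E) ρ, Summable fun k => e k x := by
    intro x hx
    obtain ⟨C, hC, h⟩ := hgeom 0 0 le_rfl
    refine Summable.of_norm_bounded ((summable_geometric_of_lt_one hθ hθ1).mul_left C) fun k => ?_
    simpa using h k x hx
  let b : ContDiffBump (0 : E) := ⟨ρ / 2, ρ, by positivity, by linarith⟩
  have hbs : tsupport b = Metric.closedBall 0 ρ := b.tsupport_eq
  refine ⟨fun x => ∑' k, b x • e k x, ?_, ?_⟩
  · have hbL : ContDiff ℝ ∞ (fun x => b x • ContinuousLinearMap.id ℝ F) :=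
      b.contDiff.smul contDiff_const
    have hbe : ∀ n, GeomBound θ (Metric.closedBall 0 ρ) n (fun k x => b x • e k x) := by
      intro n
      have h := (hgeom n).clm_apply hB hbL hes
      simpa only [smul_apply, ContinuousLinearMap.id_apply] using h
    have hj := fun j => hbe j j le_rfl
    choose C hC0 hC using hj
    have hbes : ∀ k, ContDiff ℝ ∞ (fun x => b x • e k x) := fun k => b.contDiff.smul (hes k)
    have hv : ∀ j : ℕ, Summable fun k => C j * θ ^ k := fun j =>
      (summable_geometric_of_lt_one hθ hθ1).mul_left _
    refine contDiff_tsum (N := ⊤) hbes (fun j _ => hv j) fun j k x _ => ?_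
    by_cases hx : x ∈ Metric.closedBall (0 : E) ρ
    · exact hC j k x hx
    · have : iteratedFDeriv ℝ j (fun x => b x • e k x) x = 0 := by
        by_contra hne
        refine hx ?_
        rw [← hbs]
        exact tsupport_smul_subset_left _ _ (support_iteratedFDeriv_subset j hne)
      rw [this, norm_zero]
      have := hC0 j
      positivity
  · have hnear : Metric.closedBall (0 : E) (ρ / 2) ∈ 𝓝 0 :=
      Metric.closedBall_mem_nhds _ (by positivity)
    filter_upwards [hnear] with x hx
    have hxρ : x ∈ Metric.closedBall (0 : E) ρ :=
      Metric.closedBall_subset_closedBall (by linarith) hx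
    have hφx : φ x ∈ Metric.closedBall (0 : E) (ρ / 2) := by
      have := hφle x hxρ
      simp only [mem_closedBall_zero_iff] at hx ⊢
      exact this.trans hx
    have b1 : b x = 1 := b.one_of_mem_closedBall hx
    have b2 : b (φ x) = 1 := b.one_of_mem_closedBall hφx
    simp only [b1, b2, one_smul]
    rw [(hsum x hxρ).tsum_eq_zero_add, (L x).map_tsum (hsum _ (hφB hxρ)), he0, add_comm]

end Contraction

section Hadamard

variable {E F : Type} [NormedAddCommGroup E] [NormedSpace ℝ E]
  [NormedAddCommGroup F] [NormedSpace ℝ F]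

theorem hasFDerivAt_integral_smul_comp_smul [FiniteDimensional ℝ E] {f : E → F}
    (hf : ContDiff ℝ 1 f) {w : ℝ → ℝ} (hw : Continuous w) (x₀ : E) :
    HasFDerivAt (fun x => ∫ t in (0 : ℝ)..1, w t • f (t • x))
      (∫ t in (0 : ℝ)..1, (w t * t) • fderiv ℝ f (t • x₀)) x₀ := by
  have hcf := hf.continuous
  have hcd : Continuous (fderiv ℝ f) := hf.continuous_fderiv (by simp)
  have hK : IsCompact (Set.Icc (0 : ℝ) 1 ×ˢ Metric.closedBall x₀ 1) :=
    isCompact_Icc.prod (isCompact_closedBall _ _)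
  obtain ⟨C, hC⟩ := hK.exists_bound_of_continuousOn
    (f := fun p : ℝ × E => (w p.1 * p.1) • fderiv ℝ f (p.1 • p.2)) (by fun_prop)
  refine intervalIntegral.hasFDerivAt_integral_of_dominated_of_fderiv_le
    (F := fun x t => w t • f (t • x)) (F' := fun x t => (w t * t) • fderiv ℝ f (t • x))
    (bound := fun _ => C) (Metric.closedBall_mem_nhds x₀ one_pos)
    (Filter.Eventually.of_forall fun x => ?_) ?_ ?_ ?_ ?_ ?_
  · exact (by fun_prop : Continuous fun t => w t • f (t • x)).aestronglyMeasurable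
  · exact (by fun_prop : Continuous fun t => w t • f (t • x₀)).intervalIntegrable _ _
  · exact (by fun_prop :
      Continuous fun t => (w t * t) • fderiv ℝ f (t • x₀)).aestronglyMeasurable
  · refine Filter.Eventually.of_forall fun t ht x hx => hC (t, x) ⟨?_, hx⟩
    rw [Set.uIoc_of_le zero_le_one] at ht
    exact ⟨ht.1.le, ht.2⟩
  · exact intervalIntegrable_const
  · refine Filter.Eventually.of_forall fun t _ x _ => ?_
    have h1 : HasFDerivAt f (fderiv ℝ f (t • x)) (t • x) :=
      (hf.differentiable (by simp)).differentiableAt.hasFDerivAt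
    have h2 : HasFDerivAt (fun x : E => t • x) (t • ContinuousLinearMap.id ℝ E) x :=
      (hasFDerivAt_id x).const_smul t
    convert! (h1.comp x h2).const_smul (w t) using 1
    ext v
    simp [mul_smul]

theorem contDiff_integral_smul_comp_smul [FiniteDimensional ℝ E] (n : ℕ) :
    ∀ {F : Type} [NormedAddCommGroup F] [NormedSpace ℝ F] {f : E → F} {w : ℝ → ℝ},
      ContDiff ℝ ∞ f → Continuous w →
      ContDiff ℝ n (fun x => ∫ t in (0 : ℝ)..1, w t • f (t • x)) := by
  induction n with
  | zero =>
    intro F _ _ f w hf hw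
    exact contDiff_zero.2 (continuous_iff_continuousAt.2 fun x =>
      (hasFDerivAt_integral_smul_comp_smul (hf.of_le (mod_cast le_top)) hw x).continuousAt)
  | succ n ih =>
    intro F _ _ f w hf hw
    have hd := hasFDerivAt_integral_smul_comp_smul (hf.of_le (mod_cast le_top)) hw
    rw [Nat.cast_add, Nat.cast_one, contDiff_succ_iff_hasFDerivAt (n := n)]
    exact ⟨_, ih (hf.fderiv_right le_rfl) (hw.mul continuous_id), hd⟩

/-- Hadamard's lemma. -/
theorem exists_contDiff_apply_self_eq [FiniteDimensional ℝ E] [CompleteSpace F] {f : E → F}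
    (hf : ContDiff ℝ ∞ f) (hf0 : f 0 = 0) :
    ∃ G : E → E →L[ℝ] F, ContDiff ℝ ∞ G ∧ G 0 = fderiv ℝ f 0 ∧ ∀ x, G x x = f x := by
  have hdf : ContDiff ℝ ∞ (fderiv ℝ f) := hf.fderiv_right le_rfl
  refine ⟨fun x => ∫ t in (0 : ℝ)..1, (1 : ℝ) • fderiv ℝ f (t • x), ?_, by simp, fun x => ?_⟩
  · exact contDiff_infty.2 fun n => contDiff_integral_smul_comp_smul n hdf continuous_const
  · have hcd := hdf.continuous
    have hc : Continuous fun t : ℝ => fderiv ℝ f (t • x) := by fun_prop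
    simp only [one_smul]
    rw [ContinuousLinearMap.intervalIntegral_apply (hc.intervalIntegrable _ _)]
    have key := intervalIntegral.integral_eq_sub_of_hasDerivAt (a := 0) (b := 1)
      (f := fun t : ℝ => f (t • x)) (f' := fun t => fderiv ℝ f (t • x) x) (fun t _ => ?_)
      ((by fun_prop : Continuous fun t : ℝ => fderiv ℝ f (t • x) x).intervalIntegrable _ _)
    · simpa [hf0] using key
    · have h1 : HasFDerivAt f (fderiv ℝ f (t • x)) (t • x) :=
        (hf.differentiable (by simp)).differentiableAt.hasFDerivAt
      have h2 : HasDerivAt (fun t : ℝ => t • x) x t := by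
        simpa using (hasDerivAt_id t).smul_const x
      exact h1.comp_hasDerivAt t h2

end Hadamard

section Local

variable {E F : Type} [NormedAddCommGroup E] [NormedSpace ℝ E] [FiniteDimensional ℝ E]
  [NormedAddCommGroup F] [NormedSpace ℝ F]

/-- The germ of a smooth map at a point extends to a globally smooth map. -/
theorem exists_contDiff_eventuallyEq {U : Set E} (hU : IsOpen U) {x₀ : E} (hx₀ : x₀ ∈ U) {f : E → F}
    (hf : ContDiffOn ℝ ∞ f U) : ∃ g : E → F, ContDiff ℝ ∞ g ∧ g =ᶠ[𝓝 x₀] f := by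
  obtain ⟨ρ, hρ, hball⟩ := Metric.nhds_basis_closedBall.mem_iff.1 (hU.mem_nhds hx₀)
  let b : ContDiffBump x₀ := ⟨ρ / 2, ρ, by positivity, by linarith⟩
  have hbU : tsupport b ⊆ U := by rw [b.tsupport_eq]; exact hball
  refine ⟨fun x => b x • f x, contDiff_iff_contDiffAt.2 fun x => ?_, ?_⟩
  · by_cases hx : x ∈ tsupport b
    · exact b.contDiff.contDiffAt.smul (hf.contDiffAt (hU.mem_nhds (hbU hx)))
    · refine (contDiffAt_const (c := (0 : F))).congr_of_eventuallyEq ?_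
      filter_upwards [(isClosed_tsupport b).isOpen_compl.mem_nhds hx] with y hy
      rw [image_eq_zero_of_notMem_tsupport hy, zero_smul]
  · filter_upwards [b.eventuallyEq_one] with x hx
    rw [hx, Pi.one_apply, one_smul]

end Local

section Sternberg

/-- A smooth map with identity derivative at `0` is a smooth diffeomorphism on a neighbourhood
of `0`. -/
theorem exists_isSmoothDiffeoOn {n : ℕ} {ψ : EuclideanSpace ℝ (Fin n) → EuclideanSpace ℝ (Fin n)}
    (hψ : ContDiff ℝ ∞ ψ)
    (hψ' : fderiv ℝ ψ 0 = ContinuousLinearMap.id ℝ (EuclideanSpace ℝ (Fin n))) :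
    ∃ V : Set (EuclideanSpace ℝ (Fin n)), 0 ∈ V ∧ IsSmoothDiffeoOn n ψ V := by
  have hd : ∀ x, HasFDerivAt ψ (fderiv ℝ ψ x) x := fun x =>
    (hψ.differentiable (by simp)).differentiableAt.hasFDerivAt
  have h0 : HasFDerivAt ψ ((ContinuousLinearEquiv.refl ℝ (EuclideanSpace ℝ (Fin n)) :
      EuclideanSpace ℝ (Fin n) →L[ℝ] EuclideanSpace ℝ (Fin n))) 0 := by
    have := hd 0
    rwa [hψ'] at this
  let P := hψ.contDiffAt.toOpenPartialHomeomorph ψ h0 (by simp)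
  have hP : (P : EuclideanSpace ℝ (Fin n) → EuclideanSpace ℝ (Fin n)) = ψ :=
    hψ.contDiffAt.toOpenPartialHomeomorph_coe h0 (by simp)
  let S : Set (EuclideanSpace ℝ (Fin n)) := fderiv ℝ ψ ⁻¹' Set.range
    (fun e : EuclideanSpace ℝ (Fin n) ≃L[ℝ] EuclideanSpace ℝ (Fin n) =>
      (e : EuclideanSpace ℝ (Fin n) →L[ℝ] EuclideanSpace ℝ (Fin n)))
  have hS : IsOpen S := ContinuousLinearEquiv.isOpen.preimage (hψ.continuous_fderiv (by simp))
  have himage : IsOpen (ψ '' (P.source ∩ S)) := by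
    rw [← hP]
    exact P.isOpen_image_of_subset_source (P.open_source.inter hS) Set.inter_subset_left
  have hleft : ∀ x ∈ P.source ∩ S, P.symm (ψ x) = x := fun x hx => by
    rw [← hP]
    exact P.left_inv hx.1
  refine ⟨P.source ∩ S, ⟨hψ.contDiffAt.mem_toOpenPartialHomeomorph_source h0 (by simp),
    ⟨ContinuousLinearEquiv.refl ℝ _, hψ'.symm⟩⟩, P.open_source.inter hS, hψ.contDiffOn,
    fun x hx y hy hxy => ?_, himage, P.symm, ?_, hleft⟩
  · rw [← hleft x hx, ← hleft y hy, hxy]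
  · rintro _ ⟨x, hx, rfl⟩
    obtain ⟨A, hA⟩ := hx.2
    refine ContDiffAt.contDiffWithinAt ?_
    refine P.contDiffAt_symm (f₀' := A) ?_ ?_ hψ.contDiffAt
    · rw [← hP]
      exact P.map_source hx.1
    · rw [hleft x hx, hP]
      simp only at hA
      rw [hA]
      exact hd x

variable {E : Type} [NormedAddCommGroup E] [NormedSpace ℝ E] [FiniteDimensional ℝ E]

/-- A smooth germ with derivative `lam • id`, `0 < |lam| < 1`, is conjugate to its linear part by a
smooth map tangent to the identity. -/
theorem exists_contDiff_conjugacy {lam : ℝ} (hlam0 : lam ≠ 0) (hlam1 : |lam| < 1) {φ : E → E}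
    (hφ : ContDiff ℝ ∞ φ) (hφ0 : φ 0 = 0) (hD : fderiv ℝ φ 0 = lam • ContinuousLinearMap.id ℝ E) :
    ∃ ψ : E → E, ContDiff ℝ ∞ ψ ∧ ψ 0 = 0 ∧ fderiv ℝ ψ 0 = ContinuousLinearMap.id ℝ E ∧
      ∀ᶠ x in 𝓝 0, ψ (φ x) = lam • ψ x := by
  obtain ⟨M, hM, hM0, hMx⟩ := exists_contDiff_apply_self_eq hφ hφ0
  rw [hD] at hM0
  obtain ⟨R, hR, -, hRx⟩ := exists_contDiff_apply_self_eq
    (f := fun x => M x - lam • ContinuousLinearMap.id ℝ E) (hM.sub contDiff_const) (by simp [hM0])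
  have hMnorm : ‖M 0‖ ≤ |lam| := by
    rw [hM0, norm_smul, Real.norm_eq_abs]
    exact mul_le_of_le_one_right (abs_nonneg _) ContinuousLinearMap.norm_id_le
  let pull : (E →L[ℝ] E) → (E →L[ℝ] E) →L[ℝ] (E →L[ℝ] E) :=
    fun N => sandwich (ContinuousLinearMap.id ℝ E) N
  have hpull : ContDiff ℝ ∞ fun x => pull (M x) := ContDiff.sandwich (n := ⊤) contDiff_const hM
  have hL : ContDiff ℝ ∞ fun x => sandwich (pull (M x)) (lam⁻¹ • M x) :=
    ContDiff.sandwich (n := ⊤) hpull (hM.const_smul lam⁻¹)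
  have hL1 : ‖sandwich (pull (M 0)) (lam⁻¹ • M 0)‖ < 1 := by
    have hp : ‖pull (M 0)‖ ≤ |lam| :=
      calc _ ≤ ‖ContinuousLinearMap.id ℝ E‖ * ‖M 0‖ := norm_sandwich_le _ _
        _ ≤ 1 * |lam| := by gcongr; exact ContinuousLinearMap.norm_id_le
        _ = |lam| := one_mul _
    have hpos : 0 < |lam| := abs_pos.2 hlam0
    calc _ ≤ ‖pull (M 0)‖ * ‖lam⁻¹ • M 0‖ := norm_sandwich_le _ _
      _ ≤ |lam| * (|lam|⁻¹ * |lam|) := by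
          rw [norm_smul, norm_inv, Real.norm_eq_abs]
          gcongr
      _ = |lam| := by field_simp
      _ < 1 := hlam1
  obtain ⟨u, hu, hux⟩ := exists_contDiff_solution hφ hφ0
    (by rw [hD, ← hM0]; exact hMnorm.trans_lt hlam1) hL
    (hR.const_smul lam⁻¹) hL1
  have hquad : ContDiff ℝ ∞ fun x => u x x x := (hu.clm_apply contDiff_id).clm_apply contDiff_id
  refine ⟨fun x => x + u x x x, contDiff_id.add hquad, by simp, ?_, ?_⟩
  · have hdu : HasFDerivAt u (fderiv ℝ u 0) 0 :=
      (hu.differentiable (by simp)).differentiableAt.hasFDerivAt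
    have h := (hasFDerivAt_id (𝕜 := ℝ) (0 : E)).fun_add
      ((hdu.clm_apply (hasFDerivAt_id 0)).clm_apply (hasFDerivAt_id 0))
    refine h.fderiv.trans ?_
    ext v
    simp
  · filter_upwards [hux] with x hx
    have h1 := congrArg (fun T : E →L[ℝ] E →L[ℝ] E => lam • T x x) hx
    simp only [add_apply, smul_apply, smul_add, smul_inv_smul₀ hlam0, sandwich_apply, pull, map_smul,
      ContinuousLinearMap.comp_apply, ContinuousLinearMap.id_apply, hMx, hRx, sub_apply] at h1
    simp only [smul_add, h1]
    abel

/-- The contracting case, for a map which is only assumed smooth near `0`. -/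
theorem exists_isSmoothDiffeoOn_conjugacy {n : ℕ} {lam : ℝ} (hlam0 : lam ≠ 0) (hlam1 : |lam| < 1)
    {U : Set (EuclideanSpace ℝ (Fin n))}
    {φ : EuclideanSpace ℝ (Fin n) → EuclideanSpace ℝ (Fin n)}
    (hU : IsOpen U) (h0U : 0 ∈ U) (hφ : ContDiffOn ℝ ∞ φ U) (hφ0 : φ 0 = 0)
    (hD : fderiv ℝ φ 0 = lam • ContinuousLinearMap.id ℝ (EuclideanSpace ℝ (Fin n))) :
    ∃ (V : Set (EuclideanSpace ℝ (Fin n)))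
      (ψ : EuclideanSpace ℝ (Fin n) → EuclideanSpace ℝ (Fin n)),
      0 ∈ V ∧ IsSmoothDiffeoOn n ψ V ∧ ψ 0 = 0 ∧ ∀ᶠ x in 𝓝 0, ψ (φ x) = lam • ψ x := by
  obtain ⟨g, hg, hgφ⟩ := exists_contDiff_eventuallyEq hU h0U hφ
  obtain ⟨ψ, hψ, hψ0, hψ', hconj⟩ := exists_contDiff_conjugacy hlam0 hlam1 hg
    (hgφ.eq_of_nhds.trans hφ0) (hgφ.fderiv_eq.trans hD)
  obtain ⟨V, hV, hVψ⟩ := exists_isSmoothDiffeoOn hψ hψ'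
  refine ⟨V, ψ, hV, hVψ, hψ0, ?_⟩
  filter_upwards [hconj, hgφ] with x hx hx'
  rw [← hx', hx]

end Sternberg

/-- If `φ` is a `C^∞` diffeomorphism from a neighbourhood `U` of `0 ∈ ℝⁿ` onto an open set,
`φ 0 = 0` and `D₀φ = λ • Id` with `λ ≠ 0`, `|λ| ≠ 1`, then the germ of `φ` at `0` is conjugate
to the germ of the scalar map `x ↦ λ • x`. -/
theorem sternberg_linearisation_scalar (n : ℕ) (lam : ℝ) (hlam0 : lam ≠ 0)
    (hlam1 : |lam| ≠ 1)
    (U : Set (EuclideanSpace ℝ (Fin n)))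
    (φ : EuclideanSpace ℝ (Fin n) → EuclideanSpace ℝ (Fin n))
    (h0U : (0 : EuclideanSpace ℝ (Fin n)) ∈ U)
    (hφ : IsSmoothDiffeoOn n φ U) (hφ0 : φ 0 = 0)
    (hD : fderiv ℝ φ 0 = lam • ContinuousLinearMap.id ℝ (EuclideanSpace ℝ (Fin n))) :
    ∃ (V W : Set (EuclideanSpace ℝ (Fin n)))
      (ψ : EuclideanSpace ℝ (Fin n) → EuclideanSpace ℝ (Fin n)),
      (0 : EuclideanSpace ℝ (Fin n)) ∈ V ∧ IsSmoothDiffeoOn n ψ V ∧ ψ 0 = 0 ∧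
      IsOpen W ∧ (0 : EuclideanSpace ℝ (Fin n)) ∈ W ∧ W ⊆ U ∩ V ∧
      ∀ x ∈ W, ψ (φ x) = lam • ψ x := by
  obtain ⟨hU, hφs, -, hφU, χ, hχ, hχφ⟩ := hφ
  have hφc : ContinuousAt φ 0 := (hφs.contDiffAt (hU.mem_nhds h0U)).continuousAt
  suffices h : ∃ (V : Set (EuclideanSpace ℝ (Fin n)))
      (ψ : EuclideanSpace ℝ (Fin n) → EuclideanSpace ℝ (Fin n)),
      0 ∈ V ∧ IsSmoothDiffeoOn n ψ V ∧ ψ 0 = 0 ∧ ∀ᶠ x in 𝓝 0, ψ (φ x) = lam • ψ x by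
    obtain ⟨V, ψ, h0V, hVψ, hψ0, hconj⟩ := h
    obtain ⟨W, hW, hWo, h0W⟩ := mem_nhds_iff.1
      (hconj.and ((hU.eventually_mem h0U).and (hVψ.1.eventually_mem h0V)))
    exact ⟨V, W, ψ, h0V, hVψ, hψ0, hWo, h0W, fun x hx => (hW hx).2, fun x hx => (hW hx).1⟩
  rcases lt_or_gt_of_ne hlam1 with hlt | hgt
  · exact exists_isSmoothDiffeoOn_conjugacy hlam0 hlt hU h0U hφs hφ0 hD
  have h0im : 0 ∈ φ '' U := ⟨0, h0U, hφ0⟩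
  have hχ0 : χ 0 = 0 := by simpa [hφ0] using hχφ 0 h0U
  have hχD : fderiv ℝ χ 0 = lam⁻¹ • ContinuousLinearMap.id ℝ (EuclideanSpace ℝ (Fin n)) := by
    have d1 : HasFDerivAt χ (fderiv ℝ χ 0) (φ 0) := by
      rw [hφ0]
      exact ((hχ.contDiffAt (hφU.mem_nhds h0im)).differentiableAt (by simp)).hasFDerivAt
    have d2 : HasFDerivAt φ (lam • ContinuousLinearMap.id ℝ (EuclideanSpace ℝ (Fin n))) 0 := by
      rw [← hD]
      exact ((hφs.contDiffAt (hU.mem_nhds h0U)).differentiableAt (by simp)).hasFDerivAt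
    have hid : χ ∘ φ =ᶠ[𝓝 0] id := Filter.eventually_of_mem (hU.mem_nhds h0U) hχφ
    have h := (d1.comp 0 d2).unique ((hasFDerivAt_id 0).congr_of_eventuallyEq hid)
    rw [← h]
    ext v
    simp [smul_smul, inv_mul_cancel₀ hlam0]
  obtain ⟨V, ψ, h0V, hVψ, hψ0, hconj⟩ := exists_isSmoothDiffeoOn_conjugacy (inv_ne_zero hlam0)
    (by rw [abs_inv]; exact inv_lt_one_of_one_lt₀ hgt) hφU h0im hχ hχ0 hχD
  refine ⟨V, ψ, h0V, hVψ, hψ0, ?_⟩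
  rw [ContinuousAt, hφ0] at hφc
  filter_upwards [hφc.eventually hconj, hU.mem_nhds h0U] with x hx hxU
  rw [hχφ x hxU] at hx
  rw [hx, smul_inv_smul₀ hlam0]
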